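/- arXiv:2411.12267 — 10 statements merged into one kernel-verified Lean document; each statement's English description precedes it below -/
import Mathlib

section
/- Let ε, L > 0 satisfy L·tanh(L/(2ε)) > 2ε. Then there exists exactly one real number λ in the interval [0, 1/(4ε)) such that √(1/4 − ελ) = (1/2)·tanh(L/(2ε))·tanh((L/ε)·√(1/4 − ελ)); moreover this unique solution is strictly positive. -/
open Real

theorem hasDerivAt_tanh_one_div_cosh_sq (x : ℝ) :
    HasDerivAt Real.tanh (1 / Real.cosh x ^ 2) x := by
  have hc := (Real.cosh_pos x).ne'
  have hd := (Real.hasDerivAt_sinh x).div (Real.hasDerivAt_cosh x) hc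
  have he : (Real.sinh / Real.cosh) = Real.tanh := by
    funext y
    simp [Real.tanh_eq_sinh_div_cosh]
  rw [he] at hd
  rwa [show Real.cosh x * Real.cosh x - Real.sinh x * Real.sinh x = 1 by
    linarith [Real.cosh_sq_sub_sinh_sq x, sq (Real.cosh x), sq (Real.sinh x)]] at hd

theorem continuous_tanh_real : Continuous Real.tanh :=
  continuous_iff_continuousAt.2 fun x => (hasDerivAt_tanh_one_div_cosh_sq x).continuousAt

theorem strictConcaveOn_tanh_Ici : StrictConcaveOn ℝ (Set.Ici 0) Real.tanh := by
  refine StrictAntiOn.strictConcaveOn_of_deriv (convex_Ici 0)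
    continuous_tanh_real.continuousOn ?_
  rw [interior_Ici]
  intro x hx y hy hxy
  rw [(hasDerivAt_tanh_one_div_cosh_sq x).deriv, (hasDerivAt_tanh_one_div_cosh_sq y).deriv]
  have hx0 : 0 < x := hx
  have hy0 : 0 < y := hy
  have hcosh : Real.cosh x < Real.cosh y :=
    Real.cosh_lt_cosh.2 (by rwa [abs_of_pos hx0, abs_of_pos hy0])
  have hcx := Real.cosh_pos x
  gcongr

theorem mul_tanh_lt_mul_tanh {x y : ℝ} (hx : 0 < x) (hxy : x < y) :
    x * Real.tanh y < y * Real.tanh x := by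
  have hy : 0 < y := hx.trans hxy
  have h := strictConcaveOn_tanh_Ici.2 (Set.mem_Ici.2 le_rfl) (Set.mem_Ici.2 hy.le) hy.ne
    (sub_pos.2 ((div_lt_one hy).2 hxy)) (div_pos hx hy) (sub_add_cancel 1 (x / y))
  simp only [Real.tanh_zero, smul_eq_mul, mul_zero, zero_add] at h
  rw [div_mul_cancel₀ _ hy.ne', div_mul_eq_mul_div, div_lt_iff₀ hy] at h
  linarith

theorem tanh_pos_of_pos {x : ℝ} (hx : 0 < x) : 0 < Real.tanh x := by
  rw [Real.tanh_eq_sinh_div_cosh]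
  exact div_pos (Real.sinh_pos_iff.2 hx) (Real.cosh_pos x)

theorem eq_of_eq_mul_tanh {k a s t : ℝ} (hk : 0 < k) (ha : 0 < a) (hs : 0 < s) (ht : 0 < t)
    (hse : s = k * Real.tanh (a * s)) (hte : t = k * Real.tanh (a * t)) : s = t := by
  by_contra hne
  wlog hst : s < t generalizing s t
  · exact this ht hs hte hse (Ne.symm hne) (lt_of_le_of_ne (not_lt.1 hst) (Ne.symm hne))
  have h := mul_tanh_lt_mul_tanh (mul_pos ha hs) (mul_lt_mul_of_pos_left hst ha)
  have h' := mul_lt_mul_of_pos_left h hk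
  have e1 : k * (a * s * Real.tanh (a * t)) = a * s * t := by
    rw [mul_left_comm, ← hte]
  have e2 : k * (a * t * Real.tanh (a * s)) = a * t * s := by
    rw [mul_left_comm, ← hse]
  rw [e1, e2] at h'
  linarith [mul_right_comm a s t]

theorem exists_eq_mul_tanh {k a b : ℝ} (hb : 0 < b) (hka : 1 < k * a)
    (hlt : k * Real.tanh (a * b) < b) :
    ∃ s, 0 < s ∧ s < b ∧ s = k * Real.tanh (a * s) := by
  have hd : HasDerivAt (fun s => k * Real.tanh (a * s) - s) (k * a - 1) 0 := by
    have h1 : HasDerivAt (fun s : ℝ => a * s) a 0 := by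
      simpa using (hasDerivAt_id (0 : ℝ)).const_mul a
    have h2 := ((hasDerivAt_tanh_one_div_cosh_sq (a * 0)).comp 0 h1).const_mul k
    refine HasDerivAt.sub ?_ (hasDerivAt_id (0 : ℝ))
    simpa using h2
  have hev := hd.tendsto_slope_zero_right.eventually (lt_mem_nhds (sub_pos.2 hka))
  obtain ⟨u, hu, hu0, hub⟩ := (hev.and (Ioo_mem_nhdsGT hb)).exists
  simp only [zero_add, mul_zero, Real.tanh_zero, sub_zero, smul_eq_mul] at hu
  have hpos : 0 < k * Real.tanh (a * u) - u := (mul_pos_iff_of_pos_left (inv_pos.2 hu0)).1 hu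
  have hcont : ContinuousOn (fun s => k * Real.tanh (a * s) - s) (Set.Icc u b) :=
    ((continuous_const.mul (continuous_tanh_real.comp (continuous_const.mul continuous_id))).sub
      continuous_id).continuousOn
  obtain ⟨s, hs, hs0⟩ := intermediate_value_Ioo' hub.le hcont
    (show (0 : ℝ) ∈ Set.Ioo _ _ from ⟨sub_neg.2 hlt, hpos⟩)
  exact ⟨s, hu0.trans hs.1, hs.2, (sub_eq_zero.1 hs0).symm⟩


open Real

theorem stmt_0 (ε L : ℝ) (hε : 0 < ε) (hL : 0 < L)
    (h : 2 * ε < L * Real.tanh (L / (2 * ε))) :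
    (∃! lam : ℝ, (0 ≤ lam ∧ lam < 1 / (4 * ε)) ∧
      Real.sqrt (1 / 4 - ε * lam) =
        (1 / 2) * Real.tanh (L / (2 * ε)) *
          Real.tanh ((L / ε) * Real.sqrt (1 / 4 - ε * lam))) ∧
    (∀ lam : ℝ, ((0 ≤ lam ∧ lam < 1 / (4 * ε)) ∧
      Real.sqrt (1 / 4 - ε * lam) =
        (1 / 2) * Real.tanh (L / (2 * ε)) *
          Real.tanh ((L / ε) * Real.sqrt (1 / 4 - ε * lam))) → 0 < lam) := by
  have hT0 : 0 < Real.tanh (L / (2 * ε)) := tanh_pos_of_pos (by positivity)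
  have hT1 := Real.tanh_lt_one (L / (2 * ε))
  have ha : 0 < L / ε := by positivity
  have hhalf : L / ε * (1 / 2) = L / (2 * ε) := by field_simp
  set T := Real.tanh (L / (2 * ε)) with hT
  have hka : 1 < 1 / 2 * T * (L / ε) := by
    rw [← mul_div_assoc, lt_div_iff₀ hε]
    linarith
  have hlt : 1 / 2 * T * Real.tanh (L / ε * (1 / 2)) < 1 / 2 := by
    rw [hhalf, ← hT]
    nlinarith
  have hrad : ∀ lam : ℝ, lam < 1 / (4 * ε) → 0 < 1 / 4 - ε * lam := by
    intro lam hlam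
    rw [lt_div_iff₀ (by positivity)] at hlam
    linarith
  obtain ⟨s, hs0, hs1, hs⟩ := exists_eq_mul_tanh one_half_pos hka hlt
  have huniq : ∀ lam : ℝ, ((0 ≤ lam ∧ lam < 1 / (4 * ε)) ∧
      Real.sqrt (1 / 4 - ε * lam) =
        (1 / 2) * T * Real.tanh ((L / ε) * Real.sqrt (1 / 4 - ε * lam))) →
      lam = (1 / 4 - s ^ 2) / ε := by
    rintro lam ⟨⟨-, hlam⟩, heq⟩
    have hr := hrad lam hlam
    have hst := eq_of_eq_mul_tanh (by positivity) ha (Real.sqrt_pos.2 hr) hs0 heq hs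
    rw [eq_div_iff hε.ne', ← hst, Real.sq_sqrt hr.le]
    ring
  have hpos : 0 < (1 / 4 - s ^ 2) / ε := div_pos (by nlinarith) hε
  have hsqrt : Real.sqrt (1 / 4 - ε * ((1 / 4 - s ^ 2) / ε)) = s := by
    rw [mul_div_cancel₀ _ hε.ne', sub_sub_cancel, Real.sqrt_sq hs0.le]
  refine ⟨⟨(1 / 4 - s ^ 2) / ε, ⟨⟨hpos.le, ?_⟩, ?_⟩, huniq⟩, fun lam hlam => ?_⟩
  · rw [div_lt_div_iff₀ hε (by positivity)]
    nlinarith [mul_pos hε (pow_pos hs0 2)]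
  · rwa [hsqrt]
  · rw [huniq lam hlam]
    exact hpos
end

section
/- For every L > 0 there exists a constant C > 0 such that for all ε ∈ (0, L/4), the unique solution λ0 = λ0(ε) ∈ [0, 1/(4ε)) of the first eigenvalue equation satisfies 0 < λ0 < (C/ε)·exp(−L/(2ε)). -/
open Real

theorem tanh_eq_one_sub_div (z : ℝ) : tanh z = 1 - 2 / (exp (2 * z) + 1) := by
  have h1 : exp (2 * z) = exp z * exp z := by rw [← exp_add]; ring_nf
  have h2 : exp z * exp (-z) = 1 := by rw [← exp_add]; simp
  have hp := exp_pos z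
  have hn := exp_pos (-z)
  have h3 : exp z * exp z + 1 ≠ 0 := by positivity
  rw [tanh_eq_sinh_div_cosh, sinh_eq, cosh_eq, h1]
  field_simp
  linear_combination (-2 * exp z) * h2

theorem one_sub_tanh_le (z : ℝ) : 1 - tanh z ≤ 2 * exp (-(2 * z)) := by
  have hp := exp_pos (2 * z)
  rw [tanh_eq_one_sub_div, sub_sub_cancel, exp_neg, ← div_eq_mul_inv]
  gcongr
  linarith

theorem tanh_ge_one_sub_inv {z : ℝ} (hz : 0 ≤ z) : 1 - 1 / (1 + z + z ^ 2) ≤ tanh z := by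
  have h := quadratic_le_exp_of_nonneg (x := 2 * z) (by positivity)
  have h2 : 2 / (exp (2 * z) + 1) ≤ 2 / (2 * (1 + z + z ^ 2)) := by
    gcongr
    linarith
  have h3 : 2 / (2 * (1 + z + z ^ 2)) = 1 / (1 + z + z ^ 2) := by field_simp
  rw [tanh_eq_one_sub_div]
  linarith

/-- A positive fixed point of `y ↦ tanh x * tanh (x * y)` is bounded away from zero. -/
theorem half_lt_of_eq_tanh_mul_tanh {x y : ℝ} (hx : 2 ≤ x) (hy : 0 < y)
    (h : y = tanh x * tanh (x * y)) : 1 / 2 < y := by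
  by_contra! hle
  have hT : 6 / 7 ≤ tanh x := by
    refine le_trans ?_ (tanh_ge_one_sub_inv (by linarith))
    have : 1 / (1 + x + x ^ 2) ≤ 1 / 7 := by
      gcongr
      nlinarith
    linarith
  obtain ⟨z, hz⟩ : ∃ z, z = x * y := ⟨_, rfl⟩
  have hz0 : 0 < z := by rw [hz]; positivity
  have hzx : 2 * z ≤ x := by rw [hz]; nlinarith
  rw [← hz] at h
  have ht := tanh_ge_one_sub_inv hz0.le
  have hd : 1 - 1 / (1 + z + z ^ 2) = y * (x * (1 + z) / (1 + z + z ^ 2)) := by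
    field_simp
    linear_combination (1 + z) * hz
  have hq : 7 / 6 < x * (1 + z) / (1 + z + z ^ 2) := by
    rw [lt_div_iff₀ (by positivity)]
    rcases le_total z 1 with h1 | h1 <;> nlinarith
  have hm : y * (7 / 6) < tanh z :=
    (mul_lt_mul_of_pos_left hq hy).trans_le (hd ▸ ht)
  nlinarith

theorem one_sub_le_of_eq_tanh_mul_tanh {x y : ℝ} (hx : 2 ≤ x) (hy : 0 < y)
    (h : y = tanh x * tanh (x * y)) : 1 - y ≤ 4 * exp (-x) := by
  have hhalf := half_lt_of_eq_tanh_mul_tanh hx hy h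
  have h1 := one_sub_tanh_le x
  have h2 := one_sub_tanh_le (x * y)
  have e1 : exp (-(2 * x)) ≤ exp (-x) := exp_le_exp.2 (by linarith)
  have e2 : exp (-(2 * (x * y))) ≤ exp (-x) := exp_le_exp.2 (by nlinarith)
  nlinarith [tanh_lt_one x, tanh_lt_one (x * y)]

theorem stmt_1 (L : ℝ) (hL : 0 < L) :
    ∃ C : ℝ, 0 < C ∧ ∀ ε : ℝ, 0 < ε → ε < L / 4 →
      ∀ lam : ℝ, (0 ≤ lam ∧ lam < 1 / (4 * ε)) →
        Real.sqrt (1 / 4 - ε * lam) =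
          (1 / 2) * Real.tanh (L / (2 * ε)) *
            Real.tanh ((L / ε) * Real.sqrt (1 / 4 - ε * lam)) →
        0 < lam ∧ lam < (C / ε) * Real.exp (-L / (2 * ε)) := by
  refine ⟨3, by norm_num, fun ε hε hεL lam ⟨_, hlt⟩ heq => ?_⟩
  rw [lt_div_iff₀ (by positivity)] at hlt
  have hrad : 0 < 1 / 4 - ε * lam := by linarith
  have hsq := sq_sqrt hrad.le
  have hs := sqrt_pos.2 hrad
  set s := √(1 / 4 - ε * lam)
  have hx : 2 ≤ L / (2 * ε) := by
    rw [le_div_iff₀ (by positivity)]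
    linarith
  have harg : L / ε * s = L / (2 * ε) * (2 * s) := by field_simp
  have hfix : 2 * s = tanh (L / (2 * ε)) * tanh (L / (2 * ε) * (2 * s)) := by
    rw [← harg]
    linarith
  have hy := one_sub_le_of_eq_tanh_mul_tanh hx (by positivity) hfix
  have hlt_one : 2 * s < 1 := by
    have h1 := tanh_lt_one (L / (2 * ε))
    have h2 := tanh_lt_one (L / (2 * ε) * (2 * s))
    have h3 : 0 ≤ tanh (L / (2 * ε)) := by
      rw [tanh_eq_sinh_div_cosh]
      exact div_nonneg (sinh_nonneg_iff.2 (by positivity)) (cosh_pos _).le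
    nlinarith
  constructor
  · have : 0 < ε * lam := by nlinarith
    exact pos_of_mul_pos_right this hε.le
  · have he := exp_pos (-(L / (2 * ε)))
    rw [neg_div, div_mul_eq_mul_div, lt_div_iff₀ hε]
    nlinarith
end

section
/- Let ε, L > 0 and let k ≥ 1 be an integer. Then there exists exactly one real number λ with λ > 1/(4ε) such that √(ελ − 1/4) = (ε/L)·(kπ/2 + arctan(√(4ελ − 1)/tanh(L/(2ε)))). -/
open Real

theorem concaveOn_arctan_Ici : ConcaveOn ℝ (Set.Ici 0) Real.arctan := by
  refine AntitoneOn.concaveOn_of_deriv (convex_Ici 0) continuous_arctan.continuousOn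
    differentiable_arctan.differentiableOn ?_
  intro x hx y hy hxy
  simp only [interior_Ici, Set.mem_Ioi] at hx hy
  simp only [Real.deriv_arctan]
  gcongr

theorem mul_arctan_le_mul_arctan {x y : ℝ} (hx : 0 ≤ x) (hxy : x ≤ y) :
    x * Real.arctan y ≤ y * Real.arctan x := by
  rcases hx.eq_or_lt with rfl | hx
  · simp
  have hy : 0 < y := hx.trans_le hxy
  have h := concaveOn_arctan_Ici.2 Set.self_mem_Ici (Set.mem_Ici.2 hy.le)
    (sub_nonneg.2 ((div_le_one hy).2 hxy)) (div_nonneg hx.le hy.le) (sub_add_cancel _ _)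
  simp only [smul_eq_mul, Real.arctan_zero, mul_zero, zero_add, div_mul_cancel₀ _ hy.ne'] at h
  rwa [div_mul_eq_mul_div, div_le_iff₀ hy, mul_comm (Real.arctan x)] at h

theorem existsUnique_pos_eq_mul_add_arctan {a b c : ℝ} (ha : 0 < a) (hb : 0 < b) (hc : 0 < c) :
    ∃! s : ℝ, 0 < s ∧ s = a * (b + Real.arctan (c * s)) := by
  refine existsUnique_of_exists_of_unique ?_ ?_
  · have hM : 0 ≤ a * (b + Real.pi / 2) := by positivity
    have hcont : ContinuousOn (fun s : ℝ => s - a * (b + Real.arctan (c * s)))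
        (Set.Icc 0 (a * (b + Real.pi / 2))) := by
      fun_prop
    have h0 : (0 : ℝ) - a * (b + Real.arctan (c * 0)) ≤ 0 := by
      simp only [mul_zero, Real.arctan_zero, add_zero, zero_sub, Left.neg_nonpos_iff]
      positivity
    have h1 : 0 ≤ a * (b + Real.pi / 2)
        - a * (b + Real.arctan (c * (a * (b + Real.pi / 2)))) := by
      have := (Real.arctan_lt_pi_div_two (c * (a * (b + Real.pi / 2)))).le
      rw [sub_nonneg]
      gcongr
    obtain ⟨s, hs, hs0⟩ := intermediate_value_Icc hM hcont ⟨h0, h1⟩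
    have hs1 : s = a * (b + Real.arctan (c * s)) := sub_eq_zero.1 hs0
    refine ⟨s, ?_, hs1⟩
    rw [hs1]
    have : 0 ≤ Real.arctan (c * s) := Real.arctan_nonneg.2 (mul_nonneg hc.le hs.1)
    positivity
  · have key : ∀ s t : ℝ, 0 < s → s = a * (b + Real.arctan (c * s)) →
        t = a * (b + Real.arctan (c * t)) → ¬ s < t := by
      intro s t hs hse hte hst
      have h := mul_arctan_le_mul_arctan (mul_pos hc hs).le (mul_le_mul_of_nonneg_left hst.le hc.le)
      have h' : s * Real.arctan (c * t) ≤ t * Real.arctan (c * s) := by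
        refine le_of_mul_le_mul_left ?_ hc
        simpa only [mul_assoc] using h
      have h1 : s * t = s * (a * (b + Real.arctan (c * t))) := congrArg (s * ·) hte
      have h2 : t * s = t * (a * (b + Real.arctan (c * s))) := congrArg (t * ·) hse
      have h3 := mul_le_mul_of_nonneg_left h' ha.le
      have h4 := mul_pos (mul_pos ha hb) (sub_pos.2 hst)
      linarith
    rintro s t ⟨hs, hse⟩ ⟨ht, hte⟩
    exact le_antisymm (not_lt.1 (key t s ht hte hse)) (not_lt.1 (key s t hs hse hte))

theorem sqrt_four_mul_sub_one (ε lam : ℝ) :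
    Real.sqrt (4 * ε * lam - 1) = 2 * Real.sqrt (ε * lam - 1 / 4) := by
  rw [show 4 * ε * lam - 1 = 2 ^ 2 * (ε * lam - 1 / 4) by ring,
    Real.sqrt_mul (by norm_num), Real.sqrt_sq (by norm_num)]

theorem stmt_2 (ε L : ℝ) (hε : 0 < ε) (hL : 0 < L) (k : ℕ) (hk : 1 ≤ k) :
    ∃! lam : ℝ, 1 / (4 * ε) < lam ∧
      Real.sqrt (ε * lam - 1 / 4) =
        (ε / L) * ((k : ℝ) * Real.pi / 2 +
          Real.arctan (Real.sqrt (4 * ε * lam - 1) / Real.tanh (L / (2 * ε)))) := by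
  have hk' : (0 : ℝ) < k := Nat.cast_pos.2 hk
  have hT : 0 < Real.tanh (L / (2 * ε)) := by
    rw [Real.tanh_eq_sinh_div_cosh]
    exact div_pos (Real.sinh_pos_iff.2 (by positivity)) (Real.cosh_pos _)
  obtain ⟨s, ⟨hs, hse⟩, huniq⟩ := existsUnique_pos_eq_mul_add_arctan
    (a := ε / L) (b := (k : ℝ) * Real.pi / 2) (c := 2 / Real.tanh (L / (2 * ε)))
    (by positivity) (by positivity) (by positivity)
  simp only [sqrt_four_mul_sub_one, mul_div_right_comm (2 : ℝ)]
  refine ⟨(s ^ 2 + 1 / 4) / ε, ⟨?_, ?_⟩, ?_⟩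
  · rw [div_lt_div_iff₀ (by positivity) hε]
    nlinarith [mul_pos hε (pow_pos hs 2)]
  · rwa [mul_div_cancel₀ _ hε.ne', add_sub_cancel_right, Real.sqrt_sq hs.le]
  · rintro lam ⟨hlam, hlame⟩
    have hpos : 0 < ε * lam - 1 / 4 := by
      rw [div_lt_iff₀ (by positivity)] at hlam
      linarith
    rw [eq_div_iff hε.ne', ← huniq _ ⟨Real.sqrt_pos.2 hpos, hlame⟩, Real.sq_sqrt hpos.le]
    ring
end

section
/- Let ε, L > 0 and let k ≥ 1 be an integer. The unique solution λk > 1/(4ε) of the k-th eigenvalue equation satisfies the strict bounds 1/(4ε) + k²·π²ε/(4L²) < λk < 1/(4ε) + (k+1)²·π²ε/(4L²). -/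
open Real

theorem stmt_3 (ε L : ℝ) (hε : 0 < ε) (hL : 0 < L) (k : ℕ) (hk : 1 ≤ k)
    (lam : ℝ) (hlam : 1 / (4 * ε) < lam)
    (heq : Real.sqrt (ε * lam - 1 / 4) =
      (ε / L) * ((k : ℝ) * Real.pi / 2 +
        Real.arctan (Real.sqrt (4 * ε * lam - 1) / Real.tanh (L / (2 * ε))))) :
    1 / (4 * ε) + (k : ℝ) ^ 2 * Real.pi ^ 2 * ε / (4 * L ^ 2) < lam ∧
    lam < 1 / (4 * ε) + ((k : ℝ) + 1) ^ 2 * Real.pi ^ 2 * ε / (4 * L ^ 2) := by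
  have h_pos : 0 < ε * lam - 1 / 4 := by
    rw [div_lt_iff₀ (by positivity)] at hlam
    linarith
  have h_tanh : 0 < Real.tanh (L / (2 * ε)) := by
    rw [Real.tanh_eq_sinh_div_cosh]
    exact div_pos (Real.sinh_pos_iff.2 (by positivity)) (Real.cosh_pos _)
  have h_arctan_pos :
      0 < Real.arctan (Real.sqrt (4 * ε * lam - 1) / Real.tanh (L / (2 * ε))) :=
    Real.arctan_pos.2 (div_pos (Real.sqrt_pos.2 (by linarith)) h_tanh)
  have h_arctan_lt :=
    Real.arctan_lt_pi_div_two (Real.sqrt (4 * ε * lam - 1) / Real.tanh (L / (2 * ε)))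
  have h_lower : ε / L * ((k : ℝ) * Real.pi / 2) < Real.sqrt (ε * lam - 1 / 4) := by
    rw [heq]
    gcongr
    linarith
  have h_upper : Real.sqrt (ε * lam - 1 / 4) < ε / L * (((k : ℝ) + 1) * Real.pi / 2) := by
    rw [heq]
    gcongr
    linarith
  have h_scale (a : ℝ) : (ε / L * (a * Real.pi / 2)) ^ 2 + 1 / 4 =
      ε * (1 / (4 * ε) + a ^ 2 * Real.pi ^ 2 * ε / (4 * L ^ 2)) := by
    field_simp
    ring
  rw [Real.lt_sqrt (by positivity)] at h_lower
  rw [Real.sqrt_lt' (by positivity)] at h_upper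
  constructor <;> refine lt_of_mul_lt_mul_left ?_ hε.le <;> rw [← h_scale] <;> linarith
end

section
/- Let ε, L > 0 and let j, k ≥ 1 be integers. Let λj and λk be the unique solutions greater than 1/(4ε) of the j-th and k-th eigenvalue equations respectively. Then |λk − λj| ≥ |k² − j²|·π²ε/(4L²). -/
open Real

/-- The gap between two solutions of `t = a * (m * π / 2 + arctan (2 * t / T))`, for natural
numbers `m = j < k`, controls the gap between their squares. -/
theorem sq_sub_sq_mul_le_of_eq_arctan {a T s t : ℝ} {j k : ℕ} (ha : 0 < a) (hT : 0 ≤ T)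
    (hs0 : 0 ≤ s) (ht0 : 0 ≤ t) (hjk : j < k)
    (hs : s = a * (j * π / 2 + arctan (2 * s / T)))
    (ht : t = a * (k * π / 2 + arctan (2 * t / T))) :
    ((k : ℝ) ^ 2 - (j : ℝ) ^ 2) * π ^ 2 * a ^ 2 / 4 ≤ t ^ 2 - s ^ 2 := by
  have hjk' : (j : ℝ) + 1 ≤ k := by exact_mod_cast hjk
  have hs_nonneg : 0 ≤ arctan (2 * s / T) := arctan_nonneg.2 (by positivity)
  have ht_nonneg : 0 ≤ arctan (2 * t / T) := arctan_nonneg.2 (by positivity)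
  have hst : s ≤ t := by
    rw [hs, ht]
    refine mul_le_mul_of_nonneg_left ?_ ha.le
    nlinarith [arctan_lt_pi_div_two (2 * s / T), pi_pos]
  have hmono : arctan (2 * s / T) ≤ arctan (2 * t / T) := arctan_mono (by gcongr)
  have hsub : a * ((k - j) * π / 2) ≤ t - s := by nlinarith
  have hadd : a * ((k + j) * π / 2) ≤ t + s := by nlinarith
  calc ((k : ℝ) ^ 2 - (j : ℝ) ^ 2) * π ^ 2 * a ^ 2 / 4
      = a * ((k - j) * π / 2) * (a * ((k + j) * π / 2)) := by ring
    _ ≤ (t - s) * (t + s) := mul_le_mul hsub hadd (by positivity) (sub_nonneg.2 hst)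
    _ = t ^ 2 - s ^ 2 := by ring

/-- The eigenvalue gap for two distinct indices `j < k`. -/
theorem eigenvalue_gap_of_lt {ε L : ℝ} (hε : 0 < ε) (hL : 0 < L) {j k : ℕ} (hjk : j < k)
    {lamj lamk : ℝ} (hlamj : 1 / (4 * ε) < lamj) (hlamk : 1 / (4 * ε) < lamk)
    (heqj : √(ε * lamj - 1 / 4) =
      (ε / L) * (j * π / 2 + arctan (√(4 * ε * lamj - 1) / tanh (L / (2 * ε)))))
    (heqk : √(ε * lamk - 1 / 4) =
      (ε / L) * (k * π / 2 + arctan (√(4 * ε * lamk - 1) / tanh (L / (2 * ε))))) :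
    |(k : ℝ) ^ 2 - (j : ℝ) ^ 2| * π ^ 2 * ε / (4 * L ^ 2) ≤ |lamk - lamj| := by
  have hsqrt (x : ℝ) : √(4 * ε * x - 1) = 2 * √(ε * x - 1 / 4) := by
    rw [show 4 * ε * x - 1 = 2 ^ 2 * (ε * x - 1 / 4) by ring, sqrt_mul (by positivity),
      sqrt_sq (by positivity)]
  have hsq {x : ℝ} (hx : 1 / (4 * ε) < x) : √(ε * x - 1 / 4) ^ 2 = ε * x - 1 / 4 := by
    rw [div_lt_iff₀ (by positivity)] at hx
    exact sq_sqrt (by linarith)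
  have htanh : 0 ≤ tanh (L / (2 * ε)) := by
    rw [tanh_eq_sinh_div_cosh]
    exact div_nonneg (sinh_nonneg_iff.2 (by positivity)) (cosh_pos _).le
  rw [hsqrt] at heqj heqk
  have hgap := sq_sub_sq_mul_le_of_eq_arctan (div_pos hε hL) htanh (sqrt_nonneg _)
    (sqrt_nonneg _) hjk heqj heqk
  rw [hsq hlamj, hsq hlamk] at hgap
  have hjk' : (j : ℝ) ≤ k := by exact_mod_cast hjk.le
  rw [abs_of_nonneg (by nlinarith [(j.cast_nonneg : (0 : ℝ) ≤ j)] : 0 ≤ (k : ℝ) ^ 2 - (j : ℝ) ^ 2)]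
  refine le_trans (le_of_mul_le_mul_left ?_ hε) (le_abs_self _)
  calc ε * (((k : ℝ) ^ 2 - (j : ℝ) ^ 2) * π ^ 2 * ε / (4 * L ^ 2))
      = ((k : ℝ) ^ 2 - (j : ℝ) ^ 2) * π ^ 2 * (ε / L) ^ 2 / 4 := by field_simp
    _ ≤ ε * (lamk - lamj) := by linarith

theorem stmt_4 (ε L : ℝ) (hε : 0 < ε) (hL : 0 < L) (j k : ℕ)
    (hj : 1 ≤ j) (hk : 1 ≤ k)
    (lamj lamk : ℝ) (hlamj : 1 / (4 * ε) < lamj) (hlamk : 1 / (4 * ε) < lamk)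
    (heqj : Real.sqrt (ε * lamj - 1 / 4) =
      (ε / L) * ((j : ℝ) * Real.pi / 2 +
        Real.arctan (Real.sqrt (4 * ε * lamj - 1) / Real.tanh (L / (2 * ε)))))
    (heqk : Real.sqrt (ε * lamk - 1 / 4) =
      (ε / L) * ((k : ℝ) * Real.pi / 2 +
        Real.arctan (Real.sqrt (4 * ε * lamk - 1) / Real.tanh (L / (2 * ε))))) :
    |lamk - lamj| ≥ |(k : ℝ) ^ 2 - (j : ℝ) ^ 2| * Real.pi ^ 2 * ε / (4 * L ^ 2) := by
  rcases lt_trichotomy j k with hjk | rfl | hjk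
  · exact eigenvalue_gap_of_lt hε hL hjk hlamj hlamk heqj heqk
  · simp
  · rw [abs_sub_comm lamk, abs_sub_comm ((k : ℝ) ^ 2)]
    exact eigenvalue_gap_of_lt hε hL hjk hlamk hlamj heqk heqj
end

section
/- Let ε > 0 and let u : ℝ → ℝ be twice differentiable. Set v(x) = cosh(x/(2ε))·u(x). Then for every x ∈ ℝ one has the identity −(d/dx)(tanh(x/(2ε))·u(x)) − ε·u''(x) = (1/ε)·(1/cosh(x/(2ε)))·(−ε²·v''(x) − (1/4)·v(x) + (1/2)·tanh(x/(2ε))²·v(x)). In other words, the linearized Burgers operator L^ε u = −∂x(tanh(x/(2ε))u) − ε∂x²u is conjugated by cosh(x/(2ε)) to (1/ε)·P^ε, where P^ε = −ε²∂x² − 1/4 + (1/2)tanh²(x/(2ε)). -/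
open Real

theorem hasDerivAt_tanh_eq_one_sub_sq (x : ℝ) :
    HasDerivAt Real.tanh (1 - Real.tanh x ^ 2) x := by
  have hc := (Real.cosh_pos x).ne'
  have h := (Real.hasDerivAt_sinh x).fun_div (Real.hasDerivAt_cosh x) hc
  have heq : Real.tanh = fun y => Real.sinh y / Real.cosh y :=
    funext Real.tanh_eq_sinh_div_cosh
  have hval : 1 - Real.tanh x ^ 2 =
      (Real.cosh x * Real.cosh x - Real.sinh x * Real.sinh x) / Real.cosh x ^ 2 := by
    rw [Real.tanh_eq_sinh_div_cosh]
    field_simp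
  rw [hval, heq]
  exact h

theorem stmt_5 (ε : ℝ) (hε : 0 < ε) (u : ℝ → ℝ)
    (hu : Differentiable ℝ u) (hu' : Differentiable ℝ (deriv u)) :
    ∀ x : ℝ,
      -(deriv (fun y => Real.tanh (y / (2 * ε)) * u y) x) - ε * deriv (deriv u) x =
        (1 / ε) * (1 / Real.cosh (x / (2 * ε))) *
          (-(ε ^ 2) * deriv (deriv (fun y => Real.cosh (y / (2 * ε)) * u y)) x
            - (1 / 4) * (Real.cosh (x / (2 * ε)) * u x)
            + (1 / 2) * Real.tanh (x / (2 * ε)) ^ 2 * (Real.cosh (x / (2 * ε)) * u x)) := by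
  intro x
  have hlin (y : ℝ) : HasDerivAt (fun y => y / (2 * ε)) (1 / (2 * ε)) y :=
    (hasDerivAt_id' y).div_const _
  have hcosh (y : ℝ) := (hlin y).cosh
  have hsinh (y : ℝ) := (hlin y).sinh
  have htanh : HasDerivAt (fun y => Real.tanh (y / (2 * ε)))
      ((1 - Real.tanh (x / (2 * ε)) ^ 2) * (1 / (2 * ε))) x :=
    (hasDerivAt_tanh_eq_one_sub_sq _).comp x (hlin x)
  have hv : deriv (fun y => Real.cosh (y / (2 * ε)) * u y) = fun y =>
      Real.sinh (y / (2 * ε)) * (1 / (2 * ε)) * u y + Real.cosh (y / (2 * ε)) * deriv u y :=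
    funext fun y => ((hcosh y).fun_mul (hu y).hasDerivAt).deriv
  have hv' := ((((hsinh x).mul_const (1 / (2 * ε))).fun_mul (hu x).hasDerivAt).fun_add
    ((hcosh x).fun_mul (hu' x).hasDerivAt)).deriv
  rw [(htanh.fun_mul (hu x).hasDerivAt).deriv, hv, hv', Real.tanh_eq_sinh_div_cosh]
  have hc := (Real.cosh_pos (x / (2 * ε))).ne'
  generalize Real.cosh (x / (2 * ε)) = c at *
  generalize Real.sinh (x / (2 * ε)) = s at *
  field_simp
  ring
end

section
/- Let ε, L > 0, let μ ∈ (0, 1/2), and let A, B ∈ ℝ with (A, B) ≠ (0, 0). Define f(x) = A·cosh(μx/ε) + B·sinh(μx/ε) and φ(x) = −ε·f'(x) + (1/2)·tanh(x/(2ε))·f(x). Then φ(L) = 0 and φ(−L) = 0 if and only if A = 0 and μ = (1/2)·tanh(L/(2ε))·tanh(μL/ε). -/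
open Real

theorem deriv_cosh_add_sinh (A B k ε x : ℝ) :
    deriv (fun y => A * Real.cosh (k * y / ε) + B * Real.sinh (k * y / ε)) x
      = k / ε * (A * Real.sinh (k * x / ε) + B * Real.cosh (k * x / ε)) := by
  have hlin : HasDerivAt (fun y : ℝ => k * y / ε) (k / ε) x := by
    simpa using ((hasDerivAt_id x).const_mul k).div_const ε
  refine ((hlin.cosh.const_mul A).add (hlin.sinh.const_mul B)).deriv.trans ?_
  ring

theorem tanh_strictMono : StrictMono Real.tanh := by
  intro x y hxy
  rw [Real.tanh_eq_sinh_div_cosh, Real.tanh_eq_sinh_div_cosh,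
    div_lt_div_iff₀ (Real.cosh_pos x) (Real.cosh_pos y)]
  have h := Real.sinh_pos_iff.2 (sub_pos.2 hxy)
  rw [Real.sinh_sub] at h
  linarith

theorem stmt_9 (ε L : ℝ) (hε : 0 < ε) (hL : 0 < L)
    (μ : ℝ) (hμ : μ ∈ Set.Ioo (0 : ℝ) (1 / 2))
    (A B : ℝ) (hAB : (A, B) ≠ ((0 : ℝ), (0 : ℝ))) :
    ((fun x => -ε * deriv (fun y => A * Real.cosh (μ * y / ε) + B * Real.sinh (μ * y / ε)) x
        + (1 / 2) * Real.tanh (x / (2 * ε)) *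
            (A * Real.cosh (μ * x / ε) + B * Real.sinh (μ * x / ε))) L = 0 ∧
     (fun x => -ε * deriv (fun y => A * Real.cosh (μ * y / ε) + B * Real.sinh (μ * y / ε)) x
        + (1 / 2) * Real.tanh (x / (2 * ε)) *
            (A * Real.cosh (μ * x / ε) + B * Real.sinh (μ * x / ε))) (-L) = 0)
    ↔ (A = 0 ∧ μ = (1 / 2) * Real.tanh (L / (2 * ε)) * Real.tanh (μ * L / ε)) := by
  obtain ⟨hμ0, hμ2⟩ := hμ
  have hc : 0 < Real.cosh (μ * L / ε) := Real.cosh_pos _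
  have hs : 0 < Real.sinh (μ * L / ε) := Real.sinh_pos_iff.2 (by positivity)
  have harg : μ * L / ε < L / (2 * ε) := by
    rw [div_lt_div_iff₀ hε (by positivity)]
    nlinarith [mul_pos hL hε]
  have htanh : Real.tanh (μ * L / ε) < Real.tanh (L / (2 * ε)) := tanh_strictMono harg
  rw [Real.tanh_eq_sinh_div_cosh (μ * L / ε)] at htanh ⊢
  have hL' : μ * -L / ε = -(μ * L / ε) := by ring
  have hL2 : -L / (2 * ε) = -(L / (2 * ε)) := by ring
  simp only [deriv_cosh_add_sinh, hL', hL2, Real.cosh_neg, Real.sinh_neg, Real.tanh_neg]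
  have hcancel : ∀ z : ℝ, -ε * (μ / ε * z) = -(μ * z) := fun z => by field_simp
  simp only [hcancel]
  generalize Real.tanh (L / (2 * ε)) = t at *
  generalize Real.cosh (μ * L / ε) = c at *
  generalize Real.sinh (μ * L / ε) = s at *
  rw [div_lt_iff₀ hc] at htanh
  have hgap : 0 < 1 / 2 * t * c - μ * s := by nlinarith
  have hchar : μ = 1 / 2 * t * (s / c) ↔ μ * c = 1 / 2 * t * s := by
    rw [← mul_div_assoc, eq_div_iff hc.ne']
  rw [hchar]
  constructor
  · rintro ⟨h₁, h₂⟩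
    have hA : A = 0 := by
      have h : A * (1 / 2 * t * c - μ * s) = 0 := by linear_combination (h₁ - h₂) / 2
      exact (mul_eq_zero.1 h).resolve_right hgap.ne'
    have hB : B ≠ 0 := fun hB => hAB (by rw [hA, hB])
    refine ⟨hA, mul_left_cancel₀ hB ?_⟩
    linear_combination -(h₁ + h₂) / 2
  · rintro ⟨rfl, h⟩
    constructor <;> linear_combination -B * h
end

section
/- Let L > 0. There exists ε₀ ∈ (0, L/4) such that for every ε ∈ (0, ε₀), the function ψ0(x) = cosh(x/(2ε))·(−μ0·cosh(μ0·x/ε) + (1/2)·tanh(x/(2ε))·sinh(μ0·x/ε)), where μ0 = √(1/4 − ελ0(ε)), satisfies (∫_{−L}^{L} ψ0(x)² dx)^{1/2} ≤ 2·√(2L)·|ε·ψ0'(−L)|. -/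
open Real

/-- The first adjoint eigenfunction in the rescaled variable `y = x / ε`, without the `tanh`. -/
noncomputable def rescaledEigenfunction (m y : ℝ) : ℝ :=
  -m * (cosh (y / 2) * cosh (m * y)) + 1 / 2 * (sinh (y / 2) * sinh (m * y))

theorem cosh_mul_tanh_form_eq_rescaledEigenfunction (m ε x : ℝ) :
    cosh (x / (2 * ε)) * (-m * cosh (m * x / ε) + 1 / 2 * tanh (x / (2 * ε)) * sinh (m * x / ε)) =
      rescaledEigenfunction m (x / ε) := by
  have h1 : x / (2 * ε) = x / ε / 2 := by rw [div_div, mul_comm]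
  have h2 : m * x / ε = m * (x / ε) := mul_div_assoc _ _ _
  have hc := (cosh_pos (x / ε / 2)).ne'
  rw [h1, h2, rescaledEigenfunction, tanh_eq_sinh_div_cosh]
  field_simp

theorem hasDerivAt_rescaledEigenfunction (m y : ℝ) :
    HasDerivAt (rescaledEigenfunction m) ((1 / 4 - m ^ 2) * (cosh (y / 2) * sinh (m * y))) y := by
  have h1 : HasDerivAt (fun y : ℝ => y / 2) (1 / 2) y := (hasDerivAt_id y).div_const 2
  have h2 : HasDerivAt (fun y : ℝ => m * y) m y := by
    simpa using (hasDerivAt_id y).const_mul m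
  have h := ((h1.cosh.mul h2.cosh).const_mul (-m)).add ((h1.sinh.mul h2.sinh).const_mul (1 / 2))
  refine HasDerivAt.congr_deriv (f := rescaledEigenfunction m) h ?_
  ring

theorem rescaledEigenfunction_abs (m y : ℝ) :
    rescaledEigenfunction m |y| = rescaledEigenfunction m y := by
  rcases abs_choice y with h | h
  · rw [h]
  · rw [h, rescaledEigenfunction, rescaledEigenfunction, neg_div, mul_neg]
    simp only [cosh_neg, sinh_neg, neg_mul_neg]

theorem monotoneOn_rescaledEigenfunction {m : ℝ} (h0 : 0 ≤ m) (h1 : m ≤ 1 / 2) :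
    MonotoneOn (rescaledEigenfunction m) (Set.Ici 0) := by
  refine monotoneOn_of_deriv_nonneg (convex_Ici 0)
    (fun y _ => (hasDerivAt_rescaledEigenfunction m y).continuousAt.continuousWithinAt)
    (fun y _ => (hasDerivAt_rescaledEigenfunction m y).differentiableAt.differentiableWithinAt) ?_
  intro y hy
  rw [interior_Ici, Set.mem_Ioi] at hy
  rw [(hasDerivAt_rescaledEigenfunction m y).deriv]
  have : 0 ≤ sinh (m * y) := sinh_nonneg_iff.2 (by positivity)
  have : 0 ≤ 1 / 4 - m ^ 2 := by nlinarith
  have := cosh_pos (y / 2)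
  positivity

theorem abs_rescaledEigenfunction_le {m A y : ℝ} (h0 : 0 ≤ m) (h1 : m ≤ 1 / 2)
    (hA : rescaledEigenfunction m A = 0) (hy : |y| ≤ A) :
    |rescaledEigenfunction m y| ≤ m := by
  have hmono := monotoneOn_rescaledEigenfunction h0 h1
  have hA0 : 0 ≤ A := (abs_nonneg y).trans hy
  have hlow := hmono (Set.mem_Ici.2 le_rfl) (Set.mem_Ici.2 (abs_nonneg y)) (abs_nonneg y)
  have hup := hmono (Set.mem_Ici.2 (abs_nonneg y)) (Set.mem_Ici.2 hA0) hy
  have hz : rescaledEigenfunction m 0 = -m := by simp [rescaledEigenfunction]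
  rw [rescaledEigenfunction_abs] at hlow hup
  rw [abs_le]
  constructor <;> linarith

theorem rescaledEigenfunction_eq_zero {m A : ℝ}
    (h : m = 1 / 2 * tanh (A / 2) * tanh (A * m)) : rescaledEigenfunction m A = 0 := by
  have hc1 := (cosh_pos (A / 2)).ne'
  have hc2 := (cosh_pos (A * m)).ne'
  rw [tanh_eq_sinh_div_cosh, tanh_eq_sinh_div_cosh] at h
  have h' : m * (cosh (A / 2) * cosh (A * m)) = 1 / 2 * (sinh (A / 2) * sinh (A * m)) := by
    calc m * (cosh (A / 2) * cosh (A * m))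
        = 1 / 2 * (sinh (A / 2) / cosh (A / 2)) * (sinh (A * m) / cosh (A * m)) *
            (cosh (A / 2) * cosh (A * m)) := by rw [← h]
      _ = _ := by field_simp
  rw [rescaledEigenfunction, mul_comm m A]
  linarith

/-- The boundary derivative dominates half of the sup norm of the eigenfunction. -/
theorem le_two_mul_deriv_rescaledEigenfunction {m A : ℝ} (hA : 0 ≤ A) (h0 : 0 ≤ m)
    (h1 : m ≤ 1 / 2) (h : m = 1 / 2 * tanh (A / 2) * tanh (A * m)) :
    m ≤ 2 * ((1 / 4 - m ^ 2) * (cosh (A / 2) * sinh (m * A))) := by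
  rw [mul_comm m A]
  have hc := cosh_pos (A * m)
  have hs : 0 ≤ sinh (A * m) := sinh_nonneg_iff.2 (by positivity)
  have ht : tanh (A * m) = sinh (A * m) / cosh (A * m) := tanh_eq_sinh_div_cosh _
  have ht0 : 0 ≤ tanh (A * m) := by rw [ht]; positivity
  have hT1 := tanh_lt_one (A / 2)
  have hTsq : tanh (A / 2) ^ 2 ≤ 1 := by
    have := neg_one_lt_tanh (A / 2)
    nlinarith
  have hcc : cosh (A * m) ≤ cosh (A / 2) := by
    rw [cosh_le_cosh, abs_of_nonneg (by positivity), abs_of_nonneg (by positivity)]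
    nlinarith
  have hgap : 1 / (4 * cosh (A * m) ^ 2) ≤ 1 / 4 - m ^ 2 := by
    have e : 1 / (4 * cosh (A * m) ^ 2) = 1 / 4 - 1 / 4 * tanh (A * m) ^ 2 := by
      rw [ht]
      field_simp
      linarith [cosh_sq (A * m)]
    have e2 : m ^ 2 = 1 / 4 * tanh (A / 2) ^ 2 * tanh (A * m) ^ 2 := by
      conv_lhs => rw [h]
      ring
    rw [e, e2]
    nlinarith [mul_le_mul_of_nonneg_right hTsq (sq_nonneg (tanh (A * m)))]
  calc m ≤ 1 / 2 * tanh (A * m) := by nlinarith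
    _ = 2 * (1 / (4 * cosh (A * m) ^ 2) * (cosh (A * m) * sinh (A * m))) := by
      rw [ht]
      field_simp
      ring
    _ ≤ _ := by
      have : 0 ≤ 1 / 4 - m ^ 2 := by nlinarith
      gcongr

theorem stmt_10 (L : ℝ) (hL : 0 < L) :
    ∃ ε₀ : ℝ, 0 < ε₀ ∧ ε₀ < L / 4 ∧
      ∀ ε : ℝ, 0 < ε → ε < ε₀ →
        ∀ lam : ℝ, (0 ≤ lam ∧ lam < 1 / (4 * ε)) →
          Real.sqrt (1 / 4 - ε * lam) =
            (1 / 2) * Real.tanh (L / (2 * ε)) *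
              Real.tanh ((L / ε) * Real.sqrt (1 / 4 - ε * lam)) →
          Real.sqrt (∫ x in (-L)..L,
              (Real.cosh (x / (2 * ε)) *
                (-(Real.sqrt (1 / 4 - ε * lam)) *
                    Real.cosh (Real.sqrt (1 / 4 - ε * lam) * x / ε)
                  + (1 / 2) * Real.tanh (x / (2 * ε)) *
                      Real.sinh (Real.sqrt (1 / 4 - ε * lam) * x / ε))) ^ 2)
            ≤ 2 * Real.sqrt (2 * L) *
              |ε * deriv (fun x => Real.cosh (x / (2 * ε)) *
                (-(Real.sqrt (1 / 4 - ε * lam)) *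
                    Real.cosh (Real.sqrt (1 / 4 - ε * lam) * x / ε)
                  + (1 / 2) * Real.tanh (x / (2 * ε)) *
                      Real.sinh (Real.sqrt (1 / 4 - ε * lam) * x / ε))) (-L)| := by
  refine ⟨L / 8, by positivity, by linarith, ?_⟩
  rintro ε hε - lam ⟨hlam, -⟩ heq
  have h0 : 0 ≤ √(1 / 4 - ε * lam) := Real.sqrt_nonneg _
  have h1 : √(1 / 4 - ε * lam) ≤ 1 / 2 := by
    rw [Real.sqrt_le_left (by norm_num)]
    nlinarith [mul_nonneg hε.le hlam]
  generalize √(1 / 4 - ε * lam) = m at *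
  simp only [cosh_mul_tanh_form_eq_rescaledEigenfunction]
  have hA : 0 ≤ L / ε := by positivity
  have hroot : m = 1 / 2 * tanh (L / ε / 2) * tanh (L / ε * m) := by
    rwa [div_div, mul_comm ε 2]
  have hderiv : deriv (fun x => rescaledEigenfunction m (x / ε)) (-L) =
      (1 / 4 - m ^ 2) * (cosh (-L / ε / 2) * sinh (m * (-L / ε))) * (1 / ε) :=
    (HasDerivAt.comp (h := fun x => x / ε) (-L)
      (hasDerivAt_rescaledEigenfunction m (-L / ε)) ((hasDerivAt_id (-L)).div_const ε)).deriv
  have habs : |ε * deriv (fun x => rescaledEigenfunction m (x / ε)) (-L)| =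
      |(1 / 4 - m ^ 2) * (cosh (L / ε / 2) * sinh (m * (L / ε)))| := by
    rw [hderiv, neg_div, neg_div, mul_neg, cosh_neg, sinh_neg, ← abs_neg]
    congr 1
    field_simp
  have hD := le_two_mul_deriv_rescaledEigenfunction hA h0 h1 hroot
  have hint : ∫ x in (-L)..L, rescaledEigenfunction m (x / ε) ^ 2 ≤ 2 * L * m ^ 2 := by
    have hb : ∀ x ∈ Set.uIoc (-L) L, ‖rescaledEigenfunction m (x / ε) ^ 2‖ ≤ m ^ 2 := by
      intro x hx
      rw [Set.uIoc_of_le (by linarith)] at hx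
      rw [norm_pow, Real.norm_eq_abs]
      refine pow_le_pow_left₀ (abs_nonneg _)
        (abs_rescaledEigenfunction_le h0 h1 (rescaledEigenfunction_eq_zero hroot) ?_) 2
      rw [abs_div, abs_of_pos hε]
      exact div_le_div_of_nonneg_right (abs_le.2 ⟨hx.1.le, hx.2⟩) hε.le
    have := intervalIntegral.norm_integral_le_of_norm_le_const hb
    rw [Real.norm_eq_abs, sub_neg_eq_add, abs_of_pos (by linarith : 0 < L + L)] at this
    linarith [le_abs_self (∫ x in (-L)..L, rescaledEigenfunction m (x / ε) ^ 2)]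
  calc √(∫ x in (-L)..L, rescaledEigenfunction m (x / ε) ^ 2)
      ≤ √(2 * L * m ^ 2) := Real.sqrt_le_sqrt hint
    _ = √(2 * L) * m := by rw [Real.sqrt_mul (by positivity), Real.sqrt_sq h0]
    _ ≤ √(2 * L) * (2 * |(1 / 4 - m ^ 2) * (cosh (L / ε / 2) * sinh (m * (L / ε)))|) := by
      gcongr
      exact hD.trans (by gcongr; exact le_abs_self _)
    _ = _ := by rw [habs]; ring
end

section
/- Let L > 0. There exists C > 0 such that for every ε ∈ (0, 1], every integer k ≥ 1, and every real λ with λ − 1/(4ε) ≥ k²·π²ε/(4L²), the following holds: set s = √(ελ − 1/4); if s·sin(sL/ε) + (1/2)·tanh(L/(2ε))·cos(sL/ε) = 0, then the function ψ(x) = cosh(x/(2ε))·(s·sin(s·x/ε) + (1/2)·tanh(x/(2ε))·cos(s·x/ε)) satisfies ψ(L) = ψ(−L) = 0 and (∫_{−L}^{L} ψ(x)² dx)^{1/2} ≤ (C/(k·√ε))·|ε·ψ'(−L)|. -/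
open Real

/-- The adjoint eigenfunction with the factor `cosh * tanh` simplified to `sinh`. -/
lemma cosh_mul_add_tanh_mul (ε s x : ℝ) :
    cosh (x / (2 * ε)) * (s * sin (s * x / ε) + (1 / 2) * tanh (x / (2 * ε)) * cos (s * x / ε)) =
      s * cosh (x / (2 * ε)) * sin (s * x / ε)
        + (1 / 2) * sinh (x / (2 * ε)) * cos (s * x / ε) := by
  rw [tanh_eq_sinh_div_cosh]
  have := (cosh_pos (x / (2 * ε))).ne'
  field_simp

lemma eps_mul_deriv_cosh_mul_add_tanh_mul {ε : ℝ} (hε : ε ≠ 0) (s x : ℝ) :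
    ε * deriv (fun x => cosh (x / (2 * ε)) *
        (s * sin (s * x / ε) + (1 / 2) * tanh (x / (2 * ε)) * cos (s * x / ε))) x =
      (s ^ 2 + 1 / 4) * cosh (x / (2 * ε)) * cos (s * x / ε) := by
  have h2 : HasDerivAt (fun x : ℝ => x / (2 * ε)) (1 / (2 * ε)) x := (hasDerivAt_id x).div_const _
  have h1 : HasDerivAt (fun x : ℝ => s * x / ε) (s * 1 / ε) x :=
    ((hasDerivAt_id x).const_mul s).div_const _
  have h := ((h2.cosh.const_mul s).mul h1.sin).add ((h2.sinh.const_mul (1 / 2)).mul h1.cos)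
  simp only [cosh_mul_add_tanh_mul]
  rw [HasDerivAt.deriv (f := fun x : ℝ => s * cosh (x / (2 * ε)) * sin (s * x / ε)
    + (1 / 2) * sinh (x / (2 * ε)) * cos (s * x / ε)) h]
  field_simp
  ring

lemma integral_cosh_sq_le {ε L : ℝ} (hε : 0 < ε) :
    ∫ x in (-L)..L, cosh (x / (2 * ε)) ^ 2 ≤ 3 * ε * cosh (L / (2 * ε)) ^ 2 := by
  have hF : ∀ x ∈ Set.uIcc (-L) L,
      HasDerivAt (fun x => x / 2 + ε * (sinh (x / (2 * ε)) * cosh (x / (2 * ε))))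
        (cosh (x / (2 * ε)) ^ 2) x := by
    intro x _
    have h2 : HasDerivAt (fun x : ℝ => x / (2 * ε)) (1 / (2 * ε)) x :=
      (hasDerivAt_id x).div_const _
    refine (((hasDerivAt_id x).div_const 2).add
      ((h2.sinh.mul h2.cosh).const_mul ε)).congr_deriv ?_
    have := cosh_sq (x / (2 * ε))
    field_simp
    linarith
  rw [intervalIntegral.integral_eq_sub_of_hasDerivAt hF
    (Continuous.intervalIntegrable (by fun_prop) _ _)]
  simp only [neg_div, sinh_neg, cosh_neg]
  set y := L / (2 * ε) with hy
  have hL : L = 2 * ε * y := by rw [hy]; field_simp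
  have hsq := cosh_sq y
  have hys : y ^ 2 ≤ sinh y ^ 2 := by
    rw [sq_le_sq, abs_sinh]
    exact self_le_sinh_iff.2 (abs_nonneg y)
  have hyc : 2 * y ≤ cosh y ^ 2 := by nlinarith [sq_nonneg (y - 1)]
  have hsc : 2 * (sinh y * cosh y) ≤ 2 * cosh y ^ 2 := by
    nlinarith [sq_nonneg (sinh y - cosh y)]
  have := mul_le_mul_of_nonneg_left (add_le_add hyc hsc) hε.le
  rw [hL]
  linarith

lemma sq_mul_sin_add_tanh_mul_cos_le (s y θ : ℝ) :
    (s * sin θ + (1 / 2) * tanh y * cos θ) ^ 2 ≤ s ^ 2 + 1 / 4 := by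
  have ht : tanh y ^ 2 ≤ 1 := (tanh_sq_lt_one y).le
  have h := sin_sq_add_cos_sq θ
  nlinarith [sq_nonneg (s * cos θ - (1 / 2) * tanh y * sin θ)]

lemma sq_le_cos_sq_mul {s y θ : ℝ} (h : s * sin θ + (1 / 2) * tanh y * cos θ = 0) :
    s ^ 2 ≤ cos θ ^ 2 * (s ^ 2 + 1 / 4) := by
  have ht : tanh y ^ 2 ≤ 1 := (tanh_sq_lt_one y).le
  have hsin : s ^ 2 * sin θ ^ 2 = 1 / 4 * tanh y ^ 2 * cos θ ^ 2 := by
    linear_combination (s * sin θ - (1 / 2) * tanh y * cos θ) * h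
  have h1 := sin_sq_add_cos_sq θ
  nlinarith [mul_le_mul_of_nonneg_right ht (sq_nonneg (cos θ))]

lemma integral_sq_le {ε L s : ℝ} (hε : 0 < ε) (hL : 0 < L) :
    ∫ x in (-L)..L, (cosh (x / (2 * ε)) *
        (s * sin (s * x / ε) + (1 / 2) * tanh (x / (2 * ε)) * cos (s * x / ε))) ^ 2 ≤
      (s ^ 2 + 1 / 4) * (3 * ε * cosh (L / (2 * ε)) ^ 2) := by
  calc _ ≤ ∫ x in (-L)..L, (s ^ 2 + 1 / 4) * cosh (x / (2 * ε)) ^ 2 := by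
        refine intervalIntegral.integral_mono_on (by linarith) ?_
          (Continuous.intervalIntegrable (by fun_prop) _ _) fun x _ => ?_
        · simp only [cosh_mul_add_tanh_mul]
          exact Continuous.intervalIntegrable (by fun_prop) _ _
        · rw [mul_pow, mul_comm]
          gcongr
          exact sq_mul_sin_add_tanh_mul_cos_le _ _ _
    _ ≤ _ := by
        rw [intervalIntegral.integral_const_mul]
        gcongr
        exact integral_cosh_sq_le hε

theorem stmt_11 (L : ℝ) (hL : 0 < L) :
    ∃ C : ℝ, 0 < C ∧
      ∀ ε : ℝ, ε ∈ Set.Ioc (0 : ℝ) 1 →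
        ∀ k : ℕ, 1 ≤ k →
          ∀ lam : ℝ,
            lam - 1 / (4 * ε) ≥ (k : ℝ) ^ 2 * Real.pi ^ 2 * ε / (4 * L ^ 2) →
            Real.sqrt (ε * lam - 1 / 4) * Real.sin (Real.sqrt (ε * lam - 1 / 4) * L / ε)
                + (1 / 2) * Real.tanh (L / (2 * ε)) *
                    Real.cos (Real.sqrt (ε * lam - 1 / 4) * L / ε) = 0 →
            ((fun x => Real.cosh (x / (2 * ε)) *
                (Real.sqrt (ε * lam - 1 / 4) * Real.sin (Real.sqrt (ε * lam - 1 / 4) * x / ε)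
                  + (1 / 2) * Real.tanh (x / (2 * ε)) *
                      Real.cos (Real.sqrt (ε * lam - 1 / 4) * x / ε))) L = 0 ∧
             (fun x => Real.cosh (x / (2 * ε)) *
                (Real.sqrt (ε * lam - 1 / 4) * Real.sin (Real.sqrt (ε * lam - 1 / 4) * x / ε)
                  + (1 / 2) * Real.tanh (x / (2 * ε)) *
                      Real.cos (Real.sqrt (ε * lam - 1 / 4) * x / ε))) (-L) = 0) ∧
            Real.sqrt (∫ x in (-L)..L,
                (Real.cosh (x / (2 * ε)) *
                  (Real.sqrt (ε * lam - 1 / 4) * Real.sin (Real.sqrt (ε * lam - 1 / 4) * x / ε)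
                    + (1 / 2) * Real.tanh (x / (2 * ε)) *
                        Real.cos (Real.sqrt (ε * lam - 1 / 4) * x / ε))) ^ 2)
              ≤ (C / ((k : ℝ) * Real.sqrt ε)) *
                |ε * deriv (fun x => Real.cosh (x / (2 * ε)) *
                  (Real.sqrt (ε * lam - 1 / 4) * Real.sin (Real.sqrt (ε * lam - 1 / 4) * x / ε)
                    + (1 / 2) * Real.tanh (x / (2 * ε)) *
                        Real.cos (Real.sqrt (ε * lam - 1 / 4) * x / ε))) (-L)| := by
  refine ⟨2 * L, by positivity, fun ε ⟨hε, _⟩ k hk lam hlam hs => ?_⟩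
  have hk0 : (0 : ℝ) < k := by exact_mod_cast hk
  have hlow : ((k : ℝ) * π * ε / (2 * L)) ^ 2 ≤ ε * lam - 1 / 4 := by
    have h := mul_le_mul_of_nonneg_left hlam hε.le
    have h1 : ε * (lam - 1 / (4 * ε)) = ε * lam - 1 / 4 := by field_simp
    have h2 : ε * ((k : ℝ) ^ 2 * π ^ 2 * ε / (4 * L ^ 2)) = ((k : ℝ) * π * ε / (2 * L)) ^ 2 := by
      field_simp
      ring
    rwa [h1, h2] at h
  have hsq : sqrt (ε * lam - 1 / 4) ^ 2 = ε * lam - 1 / 4 :=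
    sq_sqrt ((sq_nonneg _).trans hlow)
  rw [← hsq] at hlow
  clear hsq hlam
  generalize sqrt (ε * lam - 1 / 4) = s at *
  refine ⟨⟨by simp only [hs, mul_zero], ?_⟩, ?_⟩
  · simp only [mul_neg, neg_div, sin_neg, cos_neg, tanh_neg, cosh_neg]
    linear_combination (-cosh (L / (2 * ε))) * hs
  · rw [eps_mul_deriv_cosh_mul_add_tanh_mul hε.ne']
    refine sqrt_le_iff.2 ⟨by positivity, (integral_sq_le hε hL).trans ?_⟩
    rw [mul_pow, sq_abs, div_pow, mul_pow (k : ℝ), sq_sqrt hε.le, mul_neg, neg_div, neg_div,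
      cos_neg, cosh_neg]
    have hcos := sq_le_cos_sq_mul hs
    have hpi : (9 : ℝ) ≤ π ^ 2 := by nlinarith [pi_gt_three]
    have hlow' : 3 * ((k : ℝ) ^ 2 * ε ^ 2) ≤ 4 * L ^ 2 * s ^ 2 := by
      rw [div_pow, div_le_iff₀ (by positivity)] at hlow
      nlinarith [mul_le_mul_of_nonneg_left hpi (show 0 ≤ (k : ℝ) ^ 2 * ε ^ 2 by positivity)]
    have hkey := hlow'.trans (mul_le_mul_of_nonneg_left hcos (show 0 ≤ 4 * L ^ 2 by positivity))
    rw [div_mul_eq_mul_div, le_div_iff₀ (by positivity)]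
    have := mul_le_mul_of_nonneg_left hkey
      (show 0 ≤ (s ^ 2 + 1 / 4) * cosh (L / (2 * ε)) ^ 2 by positivity)
    linarith
end

section
/- Let L > 0. For ε ∈ (0, L/4), let λ0(ε) be the unique solution in [0, 1/(4ε)) of the first eigenvalue equation, let μ0(ε) = √(1/4 − ελ0(ε)), and let ψ0^ε(x) = cosh(x/(2ε))·(−μ0(ε)·cosh(μ0(ε)·x/ε) + (1/2)·tanh(x/(2ε))·sinh(μ0(ε)·x/ε)). Then ∫_{−L}^{L} (2·ψ0^ε(x) + 1)² dx → 0 as ε → 0⁺; that is, −2·ψ0^ε converges to the constant function 1 in L²(−L, L). -/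
open Real Filter

theorem one_sub_tanh_eq (x : ℝ) : 1 - tanh x = 2 / (exp (2 * x) + 1) := by
  have h : exp (2 * x) = exp x * exp x := by rw [← exp_add]; ring_nf
  have h0 := exp_pos x
  rw [tanh_eq_sinh_div_cosh, sinh_eq, cosh_eq, exp_neg, h]
  field_simp
  ring

theorem one_sub_tanh_pos (x : ℝ) : 0 < 1 - tanh x := by
  rw [one_sub_tanh_eq]; positivity

theorem one_sub_tanh_le_two_mul_exp (x : ℝ) : 1 - tanh x ≤ 2 * exp (-(2 * x)) := by
  rw [one_sub_tanh_eq, exp_neg, ← div_eq_mul_inv]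
  gcongr
  linarith

theorem one_sub_tanh_le_inv {x : ℝ} (hx : 0 ≤ x) : 1 - tanh x ≤ 1 / (1 + x) := by
  rw [one_sub_tanh_eq, div_le_div_iff₀ (by positivity) (by positivity)]
  linarith [add_one_le_exp (2 * x)]

theorem tanh_nonneg_of_nonneg {x : ℝ} (hx : 0 ≤ x) : 0 ≤ tanh x := by
  rw [tanh_eq_sinh_div_cosh]
  exact div_nonneg (sinh_nonneg_iff.2 hx) (cosh_pos x).le

theorem cosh_le_exp_abs (x : ℝ) : cosh x ≤ exp |x| := by
  rw [← cosh_abs, cosh_eq]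
  have : exp (-|x|) ≤ exp |x| := exp_le_exp.2 (by linarith [abs_nonneg x])
  linarith

/-- A positive root `m` of `m = tanh A * tanh (m * A)` is exponentially close to `1`. -/
theorem bounds_of_eq_tanh_mul_tanh {A m : ℝ} (hA : 0 < A) (hm : 0 < m)
    (h : m = tanh A * tanh (m * A)) :
    m ≤ 1 ∧ (1 - m) * A ≤ 2 ∧ 1 - m ≤ 2 * (1 + exp 4) * exp (-(2 * A)) := by
  have hmA : 0 < m * A := mul_pos hm hA
  have hT : 0 ≤ tanh A := tanh_nonneg_of_nonneg hA.le
  have hS : 0 ≤ tanh (m * A) := tanh_nonneg_of_nonneg hmA.le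
  have hT1 := one_sub_tanh_pos A
  have hS1 := one_sub_tanh_pos (m * A)
  have hm1 : m ≤ 1 := by rw [h]; nlinarith
  have hTA : (1 - tanh A) * A ≤ 1 := by
    have h1 := one_sub_tanh_le_inv hA.le
    rw [le_div_iff₀ (by positivity)] at h1
    linarith
  have hbound : (1 - m) * A ≤ 2 := by
    have h1 := one_sub_tanh_le_inv hmA.le
    rw [le_div_iff₀ (by positivity)] at h1
    have h2 : m * A ≤ tanh (m * A) * (1 + m * A) := by linarith
    have h3 : m * (tanh A * A) ≤ m * (1 + m * A) := by
      have := mul_le_mul_of_nonneg_left h2 hT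
      calc m * (tanh A * A) = tanh A * (m * A) := by ring
        _ ≤ tanh A * (tanh (m * A) * (1 + m * A)) := this
        _ = tanh A * tanh (m * A) * (1 + m * A) := by ring
        _ = m * (1 + m * A) := by rw [← h]
    linarith [le_of_mul_le_mul_left h3 hm]
  refine ⟨hm1, hbound, ?_⟩
  have h1 : 1 - m ≤ (1 - tanh A) + (1 - tanh (m * A)) := by
    have : 0 ≤ (1 - tanh A) * (1 - tanh (m * A)) := by positivity
    linarith
  have h2 : exp (-(2 * (m * A))) ≤ exp 4 * exp (-(2 * A)) := by
    rw [← exp_add]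
    exact exp_le_exp.2 (by linarith)
  linarith [one_sub_tanh_le_two_mul_exp A, one_sub_tanh_le_two_mul_exp (m * A)]

theorem mul_cosh_mul_cosh_le {L a m x C : ℝ} (ha : 0 < a) (hm : 0 < m) (hm1 : m ≤ 1)
    (hC : 1 - m ≤ C * exp (-(2 * (a * L)))) :
    (1 - m) * (cosh (a * x) * cosh (m * a * x)) ≤ C * exp (-(2 * (L - |x|) * a)) := by
  have h1 : cosh (a * x) ≤ exp (a * |x|) := by
    simpa [abs_mul, abs_of_pos ha] using cosh_le_exp_abs (a * x)
  have h2 : cosh (m * a * x) ≤ exp (a * |x|) := by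
    refine (cosh_le_exp_abs _).trans (exp_le_exp.2 ?_)
    rw [abs_mul, abs_of_pos (mul_pos hm ha)]
    gcongr
    exact mul_le_of_le_one_left ha.le hm1
  calc (1 - m) * (cosh (a * x) * cosh (m * a * x))
      ≤ (1 - m) * (exp (a * |x|) * exp (a * |x|)) := by
        have := (cosh_pos (m * a * x)).le
        gcongr
    _ ≤ C * exp (-(2 * (a * L))) * (exp (a * |x|) * exp (a * |x|)) := by gcongr
    _ = C * exp (-(2 * (L - |x|) * a)) := by
        rw [← exp_add, mul_assoc, ← exp_add]
        ring_nf

theorem tendsto_integral_sq_of_eq_tanh_mul_tanh {ι : Type*} {l : Filter ι}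
    [l.IsCountablyGenerated] {L : ℝ} (hL : 0 < L) {a m : ι → ℝ} (ha : Tendsto a l atTop)
    (hm : ∀ᶠ i in l, 0 < a i ∧ 0 < m i ∧ m i = tanh (a i * L) * tanh (m i * (a i * L))) :
    Tendsto (fun i => ∫ x in (-L)..L,
      (1 - cosh ((1 - m i) * a i * x) + (1 - m i) * (cosh (a i * x) * cosh (m i * a i * x))) ^ 2)
      l (nhds 0) := by
  set C : ℝ := 2 * (1 + exp 4)
  have hC0 : 0 < C := by positivity
  have hb : ∀ᶠ i in l, 0 < a i ∧ 0 < m i ∧ m i ≤ 1 ∧ (1 - m i) * (a i * L) ≤ 2 ∧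
      1 - m i ≤ C * exp (-(2 * (a i * L))) := by
    filter_upwards [hm] with i hi
    exact ⟨hi.1, hi.2.1, bounds_of_eq_tanh_mul_tanh (mul_pos hi.1 hL) hi.2.1 hi.2.2⟩
  have hdecay : Tendsto (fun i => (1 - m i) * a i) l (nhds 0) := by
    have h1 : Tendsto (fun i => C * (a i ^ (1 : ℝ) * exp (-(2 * L) * a i))) l (nhds (C * 0)) :=
      ((tendsto_rpow_mul_exp_neg_mul_atTop_nhds_zero 1 (2 * L) (by positivity)).comp ha).const_mul C
    rw [mul_zero] at h1
    refine squeeze_zero' ?_ ?_ h1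
    · filter_upwards [hb] with i ⟨h1, _, h2, _⟩
      exact mul_nonneg (by linarith) h1.le
    · filter_upwards [hb] with i ⟨h1, _, _, _, h2⟩
      rw [rpow_one]
      calc (1 - m i) * a i ≤ C * exp (-(2 * (a i * L))) * a i := by gcongr
        _ = _ := by ring_nf
  have hlim : Tendsto (fun i => ∫ x in (-L)..L,
      (1 - cosh ((1 - m i) * a i * x) + (1 - m i) * (cosh (a i * x) * cosh (m i * a i * x))) ^ 2)
      l (nhds (∫ _ in (-L)..L, (0 : ℝ))) := by
    refine intervalIntegral.tendsto_integral_filter_of_dominated_convergence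
      (fun _ => (1 + cosh 2 + C) ^ 2) ?_ ?_ intervalIntegrable_const ?_
    · exact Eventually.of_forall fun i => (by fun_prop : Continuous _).aestronglyMeasurable
    · filter_upwards [hb] with i ⟨hai, hmi, hm1, hmL, hmC⟩
      refine Eventually.of_forall fun x hx => ?_
      rw [Set.uIoc_of_le (by linarith)] at hx
      have hxL : |x| ≤ L := abs_le.2 ⟨hx.1.le, hx.2⟩
      have h1 : cosh ((1 - m i) * a i * x) ≤ cosh 2 := by
        rw [cosh_le_cosh, abs_mul, abs_of_nonneg (mul_nonneg (by linarith) hai.le), abs_two]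
        refine le_trans ?_ hmL
        rw [mul_assoc]
        have : 0 ≤ 1 - m i := by linarith
        gcongr
      have h2 := mul_cosh_mul_cosh_le (x := x) hai hmi hm1 hmC
      have h3 : exp (-(2 * (L - |x|) * a i)) ≤ 1 := by
        rw [exp_le_one_iff, neg_nonpos]
        exact mul_nonneg (by linarith) hai.le
      have h4 : C * exp (-(2 * (L - |x|) * a i)) ≤ C := mul_le_of_le_one_right hC0.le h3
      have h5 : 0 ≤ (1 - m i) * (cosh (a i * x) * cosh (m i * a i * x)) :=
        mul_nonneg (by linarith) (mul_pos (cosh_pos _) (cosh_pos _)).le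
      rw [norm_of_nonneg (sq_nonneg _)]
      refine sq_le_sq' ?_ ?_ <;> linarith [cosh_pos ((1 - m i) * a i * x), cosh_pos 2]
    · have hne : ∀ᵐ x : ℝ, x ≠ L := by
        simp [MeasureTheory.ae_iff]
      filter_upwards [hne] with x hxne hx
      rw [Set.uIoc_of_le (by linarith)] at hx
      have hxL : |x| < L := abs_lt.2 ⟨hx.1, lt_of_le_of_ne hx.2 hxne⟩
      have h1 : Tendsto (fun i => 1 - cosh ((1 - m i) * a i * x)) l (nhds 0) := by
        simpa using ((continuous_cosh.tendsto _).comp (hdecay.mul_const x)).const_sub 1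
      have h2 : Tendsto (fun i => (1 - m i) * (cosh (a i * x) * cosh (m i * a i * x))) l
          (nhds 0) := by
        have h3 : Tendsto (fun i => C * exp (-(2 * (L - |x|) * a i))) l (nhds (C * 0)) :=
          (tendsto_exp_neg_atTop_nhds_zero.comp
            (ha.const_mul_atTop (by linarith : 0 < 2 * (L - |x|)))).const_mul C
        rw [mul_zero] at h3
        refine squeeze_zero' ?_ ?_ h3
        · filter_upwards [hb] with i ⟨_, _, hm1, _⟩
          exact mul_nonneg (by linarith) (mul_pos (cosh_pos _) (cosh_pos _)).le
        · filter_upwards [hb] with i ⟨hai, hmi, hm1, _, hmC⟩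
          exact mul_cosh_mul_cosh_le hai hmi hm1 hmC
      simpa using (h1.add h2).pow 2
  simpa using hlim

theorem stmt_14 (L : ℝ) (hL : 0 < L) (lam : ℝ → ℝ)
    (hlam : ∀ ε : ℝ, ε ∈ Set.Ioo (0 : ℝ) (L / 4) →
      (0 ≤ lam ε ∧ lam ε < 1 / (4 * ε)) ∧
      Real.sqrt (1 / 4 - ε * lam ε) =
        (1 / 2) * Real.tanh (L / (2 * ε)) *
          Real.tanh ((L / ε) * Real.sqrt (1 / 4 - ε * lam ε))) :
    Filter.Tendsto
      (fun ε : ℝ =>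
        ∫ x in (-L)..L,
          (2 * (Real.cosh (x / (2 * ε)) *
            (-(Real.sqrt (1 / 4 - ε * lam ε)) *
                Real.cosh (Real.sqrt (1 / 4 - ε * lam ε) * x / ε)
              + (1 / 2) * Real.tanh (x / (2 * ε)) *
                  Real.sinh (Real.sqrt (1 / 4 - ε * lam ε) * x / ε))) + 1) ^ 2)
      (nhdsWithin 0 (Set.Ioo (0 : ℝ) (L / 4))) (nhds 0) := by
  have ha : Tendsto (fun ε : ℝ => (1 / 2) * ε⁻¹) (nhdsWithin 0 (Set.Ioo (0 : ℝ) (L / 4))) atTop :=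
    (tendsto_inv_nhdsGT_zero.mono_left
      (nhdsWithin_mono _ Set.Ioo_subset_Ioi_self)).const_mul_atTop (by norm_num)
  refine (tendsto_integral_sq_of_eq_tanh_mul_tanh hL ha
    (m := fun ε => 2 * Real.sqrt (1 / 4 - ε * lam ε)) ?_).congr' ?_
  · filter_upwards [self_mem_nhdsWithin] with ε hε
    obtain ⟨⟨-, hlt⟩, heq⟩ := hlam ε hε
    have hε0 : 0 < ε := hε.1
    refine ⟨by positivity, ?_, ?_⟩
    · rw [lt_div_iff₀ (by positivity)] at hlt
      have : 0 < 1 / 4 - ε * lam ε := by linarith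
      positivity
    · have e1 : 1 / 2 * ε⁻¹ * L = L / (2 * ε) := by field_simp
      have e2 : 2 * Real.sqrt (1 / 4 - ε * lam ε) * (L / (2 * ε)) =
          L / ε * Real.sqrt (1 / 4 - ε * lam ε) := by field_simp
      rw [e1, e2]
      linarith
  · filter_upwards [self_mem_nhdsWithin] with ε hε
    have hε0 : ε ≠ 0 := hε.1.ne'
    generalize Real.sqrt (1 / 4 - ε * lam ε) = μ
    refine intervalIntegral.integral_congr fun x _ => ?_
    have e1 : 1 / 2 * ε⁻¹ * x = x / (2 * ε) := by field_simp
    have e2 : 2 * μ * (1 / 2 * ε⁻¹) * x = μ * x / ε := by field_simp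
    have e3 : (1 - 2 * μ) * (1 / 2 * ε⁻¹) * x = x / (2 * ε) - μ * x / ε := by
      field_simp
    have hc := (cosh_pos (x / (2 * ε))).ne'
    simp only [e1, e2, e3]
    rw [cosh_sub, tanh_eq_sinh_div_cosh]
    congr 1
    field_simp
    ring
end
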